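/- Let G₁ and G₂ be r-regular simple graphs of the same order n whose signless Laplacian matrices have equal characteristic polynomials (i.e., G₁ and G₂ are signless Laplacian cospectral). Then for every simple graph G of order m, the signless Laplacian matrices Q(G₁⊠G) and Q(G₂⊠G) of the closed neighborhood coronas have equal characteristic polynomials. -/

import Mathlib

open Matrix Polynomial Finset
open scoped Kronecker

/-- Adjacency matrix of the closed neighborhood corona `G₁ ⊠ G₂`, given the adjacency
matrices `A₁`, `A₂` of the factors:
`[[A₁, 1ᵀ ⊗ (I + A₁)], [1 ⊗ (I + A₁), A₂ ⊗ I]]`. -/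
noncomputable def cncAdj {n₁ n₂ : ℕ} (A₁ : Matrix (Fin n₁) (Fin n₁) ℝ)
    (A₂ : Matrix (Fin n₂) (Fin n₂) ℝ) :
    Matrix (Fin n₁ ⊕ Fin n₂ × Fin n₁) (Fin n₁ ⊕ Fin n₂ × Fin n₁) ℝ :=
  Matrix.fromBlocks A₁
    (Matrix.of fun i p => (1 + A₁) i p.2)
    (Matrix.of fun p j => (1 + A₁) p.2 j)
    (A₂ ⊗ₖ (1 : Matrix (Fin n₁) (Fin n₁) ℝ))

/-- Degree matrix of the closed neighborhood corona, given the degree matrices of the factors: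
`diag((n₂+1)D₁ + n₂ I, D₂ ⊗ I + I ⊗ (D₁ + I))`. -/
noncomputable def cncDeg {n₁ n₂ : ℕ} (D₁ : Matrix (Fin n₁) (Fin n₁) ℝ)
    (D₂ : Matrix (Fin n₂) (Fin n₂) ℝ) :
    Matrix (Fin n₁ ⊕ Fin n₂ × Fin n₁) (Fin n₁ ⊕ Fin n₂ × Fin n₁) ℝ :=
  Matrix.fromBlocks (((n₂ : ℝ) + 1) • D₁ + (n₂ : ℝ) • 1) 0 0
    (D₂ ⊗ₖ (1 : Matrix (Fin n₁) (Fin n₁) ℝ) + (1 : Matrix (Fin n₂) (Fin n₂) ℝ) ⊗ₖ (D₁ + 1))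

/-- Laplacian matrix of the closed neighborhood corona. -/
noncomputable def cncLap {n₁ n₂ : ℕ} (A₁ D₁ : Matrix (Fin n₁) (Fin n₁) ℝ)
    (A₂ D₂ : Matrix (Fin n₂) (Fin n₂) ℝ) :
    Matrix (Fin n₁ ⊕ Fin n₂ × Fin n₁) (Fin n₁ ⊕ Fin n₂ × Fin n₁) ℝ :=
  cncDeg D₁ D₂ - cncAdj A₁ A₂

/-- Signless Laplacian matrix of the closed neighborhood corona. -/
noncomputable def cncSignlessLap {n₁ n₂ : ℕ} (A₁ D₁ : Matrix (Fin n₁) (Fin n₁) ℝ)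
    (A₂ D₂ : Matrix (Fin n₂) (Fin n₂) ℝ) :
    Matrix (Fin n₁ ⊕ Fin n₂ × Fin n₁) (Fin n₁ ⊕ Fin n₂ × Fin n₁) ℝ :=
  cncDeg D₁ D₂ + cncAdj A₁ A₂

/-- The coronal of a matrix `M` of order `n`: the sum of all entries of `(xIₙ - M)⁻¹`,
i.e. `1ₙᵀ (xIₙ - M)⁻¹ 1ₙ`. -/
noncomputable def coronal {n : ℕ} (M : Matrix (Fin n) (Fin n) ℝ) (x : ℝ) : ℝ :=
  ∑ i, ∑ j, (x • (1 : Matrix (Fin n) (Fin n) ℝ) - M)⁻¹ i j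

/-- Signless Laplacian of a simple graph: `Q = D + A`. -/
noncomputable def signlessLap {V : Type*} [Fintype V] [DecidableEq V] (G : SimpleGraph V)
    [DecidableRel G.Adj] : Matrix V V ℝ :=
  G.degMatrix ℝ + G.adjMatrix ℝ

/-- The energy of a (symmetric) real matrix: the sum of the absolute values of the roots of its
characteristic polynomial, counted with multiplicity.  For a real symmetric matrix the
characteristic polynomial splits over `ℝ`, so these are exactly its eigenvalues with
multiplicity. -/
noncomputable def menergy {n : Type*} [Fintype n] [DecidableEq n] (A : Matrix n n ℝ) : ℝ :=
  (A.charpoly.roots.map (fun t => |t|)).sum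

/-- Real symmetric matrices with the same characteristic polynomial are similar. -/
theorem Matrix.IsHermitian.exists_units_conj_of_charpoly_eq {n : Type*} [Fintype n]
    [DecidableEq n] {A B : Matrix n n ℝ} (hA : A.IsHermitian) (hB : B.IsHermitian)
    (h : A.charpoly = B.charpoly) :
    ∃ U : (Matrix n n ℝ)ˣ, U.val * A * U⁻¹.val = B := by
  have hev := (hA.eigenvalues_eq_eigenvalues_iff hB).2 h
  let u := Unitary.toUnits hA.eigenvectorUnitary
  let v := Unitary.toUnits hB.eigenvectorUnitary
  have hA' : A = u.val * diagonal hA.eigenvalues * u⁻¹.val := hA.spectral_theorem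
  have hB' : B = v.val * diagonal hB.eigenvalues * v⁻¹.val := hB.spectral_theorem
  refine ⟨v * u⁻¹, ?_⟩
  rw [← hev] at hB'
  generalize hA.eigenvalues = d at hA' hB'
  rw [hA', hB']
  simp [mul_assoc]

/-- The signless Laplacian of the closed neighborhood corona, for a regular first factor,
changes by a similarity when the adjacency matrix of the first factor does. -/
theorem charpoly_cncSignlessLap_units_conj {n m : ℕ} (U : (Matrix (Fin n) (Fin n) ℝ)ˣ)
    (A : Matrix (Fin n) (Fin n) ℝ) (r : ℝ) (C D : Matrix (Fin m) (Fin m) ℝ) :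
    (cncSignlessLap (U.val * A * U⁻¹.val) (r • 1) C D).charpoly =
      (cncSignlessLap A (r • 1) C D).charpoly := by
  let W (V : Matrix (Fin n) (Fin n) ℝ) :
      Matrix (Fin n ⊕ Fin m × Fin n) (Fin n ⊕ Fin m × Fin n) ℝ :=
    fromBlocks V 0 0 ((1 : Matrix (Fin m) (Fin m) ℝ) ⊗ₖ V)
  have hW (V V' : Matrix (Fin n) (Fin n) ℝ) (hV : V * V' = 1) : W V * W V' = 1 := by
    simp [W, fromBlocks_multiply, ← mul_kronecker_mul, hV]
  let P : (Matrix (Fin n ⊕ Fin m × Fin n) (Fin n ⊕ Fin m × Fin n) ℝ)ˣ :=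
    ⟨W U.val, W U⁻¹.val, hW _ _ U.mul_inv, hW _ _ U.inv_mul⟩
  have hrow (V B : Matrix (Fin n) (Fin n) ℝ) :
      V * (of fun i (p : Fin m × Fin n) => B i p.2) = of fun i p => (V * B) i p.2 := by
    ext i p
    simp [mul_apply]
  have hrow' (V B : Matrix (Fin n) (Fin n) ℝ) :
      (of fun i (p : Fin m × Fin n) => B i p.2) * ((1 : Matrix (Fin m) (Fin m) ℝ) ⊗ₖ V) =
        of fun i p => (B * V) i p.2 := by
    ext i p
    simp [mul_apply, Fintype.sum_prod_type, one_apply]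
  have hcol (V B : Matrix (Fin n) (Fin n) ℝ) :
      (of fun (p : Fin m × Fin n) j => B p.2 j) * V = of fun p j => (B * V) p.2 j := by
    ext p j
    simp [mul_apply]
  have hcol' (V B : Matrix (Fin n) (Fin n) ℝ) :
      ((1 : Matrix (Fin m) (Fin m) ℝ) ⊗ₖ V) * (of fun (p : Fin m × Fin n) j => B p.2 j) =
        of fun p j => (V * B) p.2 j := by
    ext p j
    simp [mul_apply, Fintype.sum_prod_type, one_apply]
  have hconj : U.val * (1 + A) = (1 + U.val * A * U⁻¹.val) * U.val := by
    simp [mul_add, add_mul, mul_assoc]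
  have hcomm : W U.val * cncSignlessLap A (r • 1) C D =
      cncSignlessLap (U.val * A * U⁻¹.val) (r • 1) C D * W U.val := by
    simp only [cncSignlessLap, cncDeg, cncAdj, W, fromBlocks_add, fromBlocks_multiply, zero_add,
      Matrix.zero_mul, Matrix.mul_zero, add_zero, hrow, hrow', hcol, hcol', hconj]
    congr 1
    · simp [mul_add, add_mul, mul_assoc]
    · simp [mul_add, add_mul, ← mul_kronecker_mul]
  have hP : cncSignlessLap (U.val * A * U⁻¹.val) (r • 1) C D =
      P.val * cncSignlessLap A (r • 1) C D * P⁻¹.val := by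
    rw [Units.eq_mul_inv_iff_mul_eq]
    exact hcomm.symm
  rw [hP, coe_units_inv, charpoly_units_conj]

theorem SimpleGraph.IsRegularOfDegree.degMatrix_eq {V : Type*} [Fintype V] [DecidableEq V]
    {G : SimpleGraph V} [DecidableRel G.Adj] {r : ℕ} (h : G.IsRegularOfDegree r) :
    G.degMatrix ℝ = (r : ℝ) • 1 := by
  simp only [SimpleGraph.degMatrix, h.degree_eq, smul_one_eq_diagonal]

theorem isHermitian_signlessLap {V : Type*} [Fintype V] [DecidableEq V]
    (G : SimpleGraph V) [DecidableRel G.Adj] : (signlessLap G).IsHermitian := by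
  refine .add (isHermitian_diagonal _) ?_
  rw [IsHermitian, conjTranspose_eq_transpose_of_trivial, SimpleGraph.transpose_adjMatrix]

/-- If `G₁` and `G₂` are `r`-regular and signless Laplacian cospectral, then `G₁ ⊠ G` and
`G₂ ⊠ G` are signless Laplacian cospectral for every graph `G`. -/
theorem cnc_signlessLap_cospectral_left {n m r : ℕ} (G₁ G₂ : SimpleGraph (Fin n))
    [DecidableRel G₁.Adj] [DecidableRel G₂.Adj]
    (hreg₁ : G₁.IsRegularOfDegree r) (hreg₂ : G₂.IsRegularOfDegree r)
    (h : (signlessLap G₁).charpoly = (signlessLap G₂).charpoly)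
    (G : SimpleGraph (Fin m)) [DecidableRel G.Adj] :
    (cncSignlessLap (G₁.adjMatrix ℝ) (G₁.degMatrix ℝ) (G.adjMatrix ℝ) (G.degMatrix ℝ)).charpoly
      = (cncSignlessLap (G₂.adjMatrix ℝ) (G₂.degMatrix ℝ) (G.adjMatrix ℝ) (G.degMatrix ℝ)).charpoly := by
  obtain ⟨U, hU⟩ := (isHermitian_signlessLap G₁).exists_units_conj_of_charpoly_eq
    (isHermitian_signlessLap G₂) h
  have hA : U.val * G₁.adjMatrix ℝ * U⁻¹.val = G₂.adjMatrix ℝ := by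
    simpa [signlessLap, hreg₁.degMatrix_eq, hreg₂.degMatrix_eq, mul_add, add_mul] using hU
  rw [hreg₁.degMatrix_eq, hreg₂.degMatrix_eq, ← hA, charpoly_cncSignlessLap_units_conj]
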